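/- arXiv:2505.11673 — 9 statements merged into one kernel-verified Lean document; each statement's English description precedes it below -/
import Mathlib

section
/- Let n ≥ 2 be an integer, let Σ be an n×n real symmetric positive definite matrix, let D be the (n−1)×n first-difference matrix, and set c := 𝟙ᵀΣ⁻¹𝟙 (a positive real scalar). Then the matrix DΣDᵀ is invertible and Σ⁻¹ − c⁻¹ · Σ⁻¹𝟙𝟙ᵀΣ⁻¹ = Dᵀ(DΣDᵀ)⁻¹D; that is, the generalized least squares weight matrix Ω of the level model equals the weight matrix Ψ of the first-difference model. -/
open Matrix

lemma fd_mulVec (m : ℕ) (D : Matrix (Fin m) (Fin (m+1)) ℝ)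
    (hD : ∀ i j, D i j =
      if (j : ℕ) = (i : ℕ) then -1 else if (j : ℕ) = (i : ℕ) + 1 then 1 else 0)
    (w : Fin (m+1) → ℝ) (i : Fin m) : (D *ᵥ w) i = w i.succ - w i.castSucc := by
  have h : ∀ j, D i j * w j =
      (if j = i.succ then w j else 0) - (if j = i.castSucc then w j else 0) := by
    intro j
    rw [hD]
    have h1 : j = i.succ ↔ (j : ℕ) = i + 1 := by simp [Fin.ext_iff]
    have h2 : j = i.castSucc ↔ (j : ℕ) = i := by simp [Fin.ext_iff]
    simp only [h1, h2]
    split_ifs <;> first | omega | ring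
  simp only [mulVec, dotProduct, h, Finset.sum_sub_distrib, Finset.sum_ite_eq', Finset.sum_ite_eq,
    Finset.mem_univ, if_true]

lemma fd_main (m : ℕ)
    (S : Matrix (Fin (m+1)) (Fin (m+1)) ℝ) (hS : S.PosDef)
    (D : Matrix (Fin m) (Fin (m+1)) ℝ)
    (hD : ∀ i j, D i j =
      if (j : ℕ) = (i : ℕ) then -1 else if (j : ℕ) = (i : ℕ) + 1 then 1 else 0)
    (c : ℝ) (hc : c = (1 : Fin (m+1) → ℝ) ⬝ᵥ (S⁻¹ *ᵥ (1 : Fin (m+1) → ℝ))) :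
    IsUnit (D * S * Dᵀ).det ∧
      S⁻¹ - c⁻¹ • vecMulVec (S⁻¹ *ᵥ (1 : Fin (m+1) → ℝ)) ((1 : Fin (m+1) → ℝ) ᵥ* S⁻¹)
        = Dᵀ * (D * S * Dᵀ)⁻¹ * D := by
  have hDv := fd_mulVec m D hD
  have hD1 : D *ᵥ (1 : Fin (m+1) → ℝ) = 0 := by
    ext i; rw [hDv]; simp
  have hker : ∀ w, D *ᵥ w = 0 → w = w 0 • (1 : Fin (m+1) → ℝ) := by
    intro w hw
    ext j
    induction j using Fin.induction with
    | zero => simp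
    | succ i ih =>
      have := congrFun hw i
      rw [hDv] at this
      simp at this ih ⊢
      linarith
  obtain ⟨L, hL⟩ : ∃ L : Matrix (Fin (m+1)) (Fin m) ℝ, D * L = 1 := by
    refine ⟨Matrix.of fun j k => if (k : ℕ) < j then 1 else 0, ?_⟩
    ext i k
    have := hDv (fun j => if (k : ℕ) < j then 1 else 0) i
    refine this.trans ?_
    simp only [Fin.val_succ, Fin.val_castSucc, one_apply, Fin.ext_iff]
    split_ifs <;> first | omega | norm_num
  have hinj : Function.Injective D.vecMul := by
    intro x y h
    have := congrArg (fun z => z ᵥ* L) h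
    simpa [vecMul_vecMul, hL] using this
  have hP : (D * S * Dᵀ).PosDef := by
    have := hS.mul_mul_conjTranspose_same (B := D) hinj
    simpa [conjTranspose_eq_transpose_of_trivial] using this
  have hG : IsUnit (D * S * Dᵀ).det := (isUnit_iff_isUnit_det _).1 hP.isUnit
  have hSu : IsUnit S.det := (isUnit_iff_isUnit_det _).1 hS.isUnit
  have hcpos : 0 < c := by
    have := hS.inv.dotProduct_mulVec_pos (x := (1 : Fin (m+1) → ℝ)) one_ne_zero
    simpa [hc] using this
  refine ⟨hG, ?_⟩
  apply ext_of_mulVec_single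
  intro k
  generalize (Pi.single k 1 : Fin (m+1) → ℝ) = x
  rw [← sub_eq_zero, ← sub_mulVec]
  set M := S⁻¹ - c⁻¹ • vecMulVec (S⁻¹ *ᵥ (1 : Fin (m+1) → ℝ)) ((1 : Fin (m+1) → ℝ) ᵥ* S⁻¹)
        - Dᵀ * (D * S * Dᵀ)⁻¹ * D with hM
  have e1 : D * S * M = 0 := by
    have a : D * S * (Dᵀ * (D * S * Dᵀ)⁻¹ * D) = D := by
      rw [← Matrix.mul_assoc, ← Matrix.mul_assoc, mul_nonsing_inv _ hG, Matrix.one_mul]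
    have b : D * S * S⁻¹ = D := by rw [Matrix.mul_assoc, mul_nonsing_inv _ hSu, Matrix.mul_one]
    rw [hM, Matrix.mul_sub, Matrix.mul_sub, a, b, Matrix.mul_smul, mul_vecMulVec, mulVec_mulVec,
      b, hD1]
    simp
  have e2 : (1 : Fin (m+1) → ℝ) ᵥ* M = 0 := by
    have a : (1 : Fin (m+1) → ℝ) ᵥ* Dᵀ = 0 := by rw [vecMul_transpose, hD1]
    rw [hM, vecMul_sub, vecMul_sub, ← vecMul_vecMul, ← vecMul_vecMul, a, vecMul_smul,
      vecMul_vecMulVec, ← hc, smul_smul, inv_mul_cancel₀ hcpos.ne']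
    simp
  have h1 : D *ᵥ (S *ᵥ (M *ᵥ x)) = 0 := by
    rw [mulVec_mulVec, mulVec_mulVec, e1, zero_mulVec]
  have h2 : (1 : Fin (m+1) → ℝ) ⬝ᵥ (M *ᵥ x) = 0 := by
    rw [dotProduct_mulVec, e2, zero_dotProduct]
  have h3 := hker _ h1
  generalize (S *ᵥ (M *ᵥ x)) 0 = l at h3
  have h4 : M *ᵥ x = l • (S⁻¹ *ᵥ (1 : Fin (m+1) → ℝ)) := by
    rw [← mulVec_smul, ← h3, mulVec_mulVec, nonsing_inv_mul _ hSu, one_mulVec]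
  rw [h4, dotProduct_smul, ← hc, smul_eq_mul] at h2
  have hl : l = 0 := (mul_eq_zero.1 h2).resolve_right hcpos.ne'
  rw [h4, hl, zero_smul]

/-- For `n ≥ 2`, a symmetric positive definite `Σ`, the first-difference matrix `D`,
and `c := 𝟙ᵀΣ⁻¹𝟙`, the matrix `DΣDᵀ` is invertible and
`Σ⁻¹ − c⁻¹ Σ⁻¹𝟙𝟙ᵀΣ⁻¹ = Dᵀ(DΣDᵀ)⁻¹D`. -/
theorem gls_weight_level_eq_difference (n : ℕ) (hn : 2 ≤ n)
    (S : Matrix (Fin n) (Fin n) ℝ) (hS : S.PosDef)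
    (D : Matrix (Fin (n - 1)) (Fin n) ℝ)
    (hD : ∀ i j, D i j =
      if (j : ℕ) = (i : ℕ) then -1 else if (j : ℕ) = (i : ℕ) + 1 then 1 else 0)
    (c : ℝ) (hc : c = (1 : Fin n → ℝ) ⬝ᵥ (S⁻¹ *ᵥ (1 : Fin n → ℝ))) :
    IsUnit (D * S * Dᵀ).det ∧
      S⁻¹ - c⁻¹ • vecMulVec (S⁻¹ *ᵥ (1 : Fin n → ℝ)) ((1 : Fin n → ℝ) ᵥ* S⁻¹)
        = Dᵀ * (D * S * Dᵀ)⁻¹ * D := by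
  obtain ⟨m, rfl⟩ : ∃ m, n = m + 1 := ⟨n - 1, by omega⟩
  exact fd_main m S hS D hD c hc
end

section
/- Let n ≥ 2 be an integer, let Σ be an n×n real symmetric positive definite matrix, let D be the (n−1)×n first-difference matrix, and set c := 𝟙ᵀΣ⁻¹𝟙. Then the n×n identity matrix decomposes as Iₙ = c⁻¹ · Σ⁻¹𝟙𝟙ᵀ + Dᵀ(DΣDᵀ)⁻¹DΣ. -/
open Matrix

/-- The action of the first-difference matrix. -/
theorem diff_mulVec (m : ℕ) (D : Matrix (Fin m) (Fin (m + 1)) ℝ)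
    (hD : ∀ i j, D i j =
      if (j : ℕ) = (i : ℕ) then -1 else if (j : ℕ) = (i : ℕ) + 1 then 1 else 0)
    (x : Fin (m + 1) → ℝ) (i : Fin m) : (D *ᵥ x) i = x i.succ - x i.castSucc := by
  have h : ∀ j, D i j * x j = (if j = i.succ then x j else 0) - (if j = i.castSucc then x j else 0) := by
    intro j
    rw [hD]
    have h1 : j = i.succ ↔ (j : ℕ) = i + 1 := by simp [Fin.ext_iff]
    have h2 : j = i.castSucc ↔ (j : ℕ) = i := by simp [Fin.ext_iff]
    simp only [h1, h2]
    split_ifs <;> first | omega | simp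
  simp only [mulVec, dotProduct, h, Finset.sum_sub_distrib]
  simp

theorem identity_aux (m : ℕ)
    (S : Matrix (Fin (m + 1)) (Fin (m + 1)) ℝ) (hS : S.PosDef)
    (D : Matrix (Fin m) (Fin (m + 1)) ℝ)
    (hD : ∀ i j, D i j =
      if (j : ℕ) = (i : ℕ) then -1 else if (j : ℕ) = (i : ℕ) + 1 then 1 else 0)
    (c : ℝ) (hc : c = (1 : Fin (m + 1) → ℝ) ⬝ᵥ (S⁻¹ *ᵥ (1 : Fin (m + 1) → ℝ))) :
    (1 : Matrix (Fin (m + 1)) (Fin (m + 1)) ℝ)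
      = c⁻¹ • vecMulVec (S⁻¹ *ᵥ (1 : Fin (m + 1) → ℝ)) (1 : Fin (m + 1) → ℝ)
        + Dᵀ * (D * S * Dᵀ)⁻¹ * (D * S) := by
  have hmv := diff_mulVec m D hD
  have hD1 : D *ᵥ (1 : Fin (m + 1) → ℝ) = 0 := by
    ext i; rw [hmv]; simp
  have hSu : IsUnit S.det := hS.isUnit.map Matrix.detMonoidHom
  have hcpos : 0 < c := by
    have := hS.inv.dotProduct_mulVec_pos (x := (1 : Fin (m + 1) → ℝ)) one_ne_zero
    rw [hc]; simpa using this
  -- right inverse of D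
  let R : Matrix (Fin (m + 1)) (Fin m) ℝ := fun j k => if (k : ℕ) < j then 1 else 0
  have hDR : D * R = 1 := by
    ext i k
    have := hmv (fun j => R j k) i
    have h2 : (D * R) i k = (D *ᵥ (fun j => R j k)) i := rfl
    rw [h2, this, Matrix.one_apply]
    simp only [R, Fin.val_succ, Fin.val_castSucc, Fin.ext_iff]
    split_ifs <;> first | omega | simp
  have hinj : Function.Injective D.vecMul := by
    intro v w h
    have := congrArg (fun z => z ᵥ* R) h
    simpa [Matrix.vecMul_vecMul, hDR] using this
  have hP : (D * S * Dᵀ).PosDef := by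
    have := hS.mul_mul_conjTranspose_same hinj
    simpa [Matrix.conjTranspose_eq_transpose_of_trivial] using this
  have hPu : IsUnit (D * S * Dᵀ).det := hP.isUnit.map Matrix.detMonoidHom
  set M := Dᵀ * (D * S * Dᵀ)⁻¹ * (D * S) with hM
  set u := S⁻¹ *ᵥ (1 : Fin (m + 1) → ℝ) with hu
  have hSu1 : S *ᵥ u = 1 := by
    rw [hu, Matrix.mulVec_mulVec, Matrix.mul_nonsing_inv _ hSu, Matrix.one_mulVec]
  have hDM : D * S * M = D * S := by
    rw [hM, ← Matrix.mul_assoc (D * S), ← Matrix.mul_assoc (D * S) Dᵀ,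
      Matrix.mul_nonsing_inv _ hPu, Matrix.one_mul]
  have h1M : (1 : Fin (m + 1) → ℝ) ᵥ* M = 0 := by
    rw [hM, Matrix.mul_assoc, ← Matrix.vecMul_vecMul, Matrix.vecMul_transpose, hD1,
      Matrix.zero_vecMul]
  -- it suffices to check on vectors
  refine Matrix.ext_of_mulVec_single fun j => ?_
  generalize (Pi.single j 1 : Fin (m + 1) → ℝ) = x
  rw [Matrix.one_mulVec, Matrix.add_mulVec, Matrix.smul_mulVec, Matrix.vecMulVec_mulVec]
  have hDy : D *ᵥ (S *ᵥ (x - M *ᵥ x)) = 0 := by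
    rw [Matrix.mulVec_mulVec, Matrix.mulVec_sub, Matrix.mulVec_mulVec, hDM, sub_self]
  have hconst : ∀ y : Fin (m + 1) → ℝ, D *ᵥ y = 0 → y = y 0 • (1 : Fin (m + 1) → ℝ) := by
    intro y hy
    ext k
    induction k using Fin.induction with
    | zero => simp
    | succ i ih =>
      have := congrFun hy i
      rw [hmv] at this
      simp at this ih ⊢
      linarith
  have hy := hconst _ hDy
  set a := (S *ᵥ (x - M *ᵥ x)) 0
  have hz : x - M *ᵥ x = a • u := by
    have := congrArg (fun z => S⁻¹ *ᵥ z) hy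
    simpa [Matrix.mulVec_mulVec, Matrix.nonsing_inv_mul _ hSu, Matrix.mulVec_smul, ← hu,
      -Matrix.mulVec_sub, -Matrix.mulVec_one] using this
  have hdot : (1 : Fin (m + 1) → ℝ) ⬝ᵥ x = a * c := by
    have := congrArg (fun z => (1 : Fin (m + 1) → ℝ) ⬝ᵥ z) hz
    simp only [dotProduct_sub, dotProduct_smul, ← hc, Matrix.dotProduct_mulVec, h1M,
      zero_dotProduct, sub_zero, smul_eq_mul] at this
    exact this
  rw [hdot]
  have : x = a • u + M *ᵥ x := by rw [← hz]; simp
  conv_lhs => rw [this]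
  congr 1
  ext k
  simp
  field_simp

/-- For `n ≥ 2`, a symmetric positive definite `Σ`, the first-difference matrix `D`,
and `c := 𝟙ᵀΣ⁻¹𝟙`, the identity decomposes as
`Iₙ = c⁻¹ Σ⁻¹𝟙𝟙ᵀ + Dᵀ(DΣDᵀ)⁻¹DΣ`. -/
theorem identity_decomposition (n : ℕ) (hn : 2 ≤ n)
    (S : Matrix (Fin n) (Fin n) ℝ) (hS : S.PosDef)
    (D : Matrix (Fin (n - 1)) (Fin n) ℝ)
    (hD : ∀ i j, D i j =
      if (j : ℕ) = (i : ℕ) then -1 else if (j : ℕ) = (i : ℕ) + 1 then 1 else 0)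
    (c : ℝ) (hc : c = (1 : Fin n → ℝ) ⬝ᵥ (S⁻¹ *ᵥ (1 : Fin n → ℝ))) :
    (1 : Matrix (Fin n) (Fin n) ℝ)
      = c⁻¹ • vecMulVec (S⁻¹ *ᵥ (1 : Fin n → ℝ)) (1 : Fin n → ℝ)
        + Dᵀ * (D * S * Dᵀ)⁻¹ * (D * S) := by
  obtain ⟨m, rfl⟩ : ∃ m, n = m + 1 := ⟨n - 1, by omega⟩
  exact identity_aux m S hS D hD c hc
end

section
/- Let n ≥ 2 be an integer, let Σ be an n×n real symmetric positive definite matrix, let D be the (n−1)×n first-difference matrix, and set c := 𝟙ᵀΣ⁻¹𝟙. Define P₁ := c⁻¹ · Σ⁻¹𝟙𝟙ᵀ and P₂ := Dᵀ(DΣDᵀ)⁻¹DΣ. Then P₁ and P₂ are idempotent (P₁² = P₁ and P₂² = P₂) and mutually annihilating: P₁P₂ = 0 and P₂P₁ = 0; i.e., P₁ and P₂ are complementary Σ-orthogonal projections onto the column space of Σ⁻¹𝟙 and the column space of Dᵀ respectively. -/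
open Matrix

/-- `P₁ := c⁻¹ Σ⁻¹𝟙𝟙ᵀ` and `P₂ := Dᵀ(DΣDᵀ)⁻¹DΣ` are idempotent and mutually
annihilating, i.e. complementary Σ-orthogonal projections. -/
theorem complementary_projections (n : ℕ) (hn : 2 ≤ n)
    (S : Matrix (Fin n) (Fin n) ℝ) (hS : S.PosDef)
    (D : Matrix (Fin (n - 1)) (Fin n) ℝ)
    (hD : ∀ i j, D i j =
      if (j : ℕ) = (i : ℕ) then -1 else if (j : ℕ) = (i : ℕ) + 1 then 1 else 0)
    (c : ℝ) (hc : c = (1 : Fin n → ℝ) ⬝ᵥ (S⁻¹ *ᵥ (1 : Fin n → ℝ)))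
    (P₁ P₂ : Matrix (Fin n) (Fin n) ℝ)
    (hP₁ : P₁ = c⁻¹ • vecMulVec (S⁻¹ *ᵥ (1 : Fin n → ℝ)) (1 : Fin n → ℝ))
    (hP₂ : P₂ = Dᵀ * (D * S * Dᵀ)⁻¹ * (D * S)) :
    P₁ * P₁ = P₁ ∧ P₂ * P₂ = P₂ ∧ P₁ * P₂ = 0 ∧ P₂ * P₁ = 0 := by
  have hD1 : D *ᵥ (1 : Fin n → ℝ) = 0 := by
    funext i
    have hi := i.isLt
    have h : ∀ j : Fin n, D i j =
        (if j = (⟨i, by omega⟩ : Fin n) then (-1 : ℝ) else 0) +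
        (if j = (⟨i + 1, by omega⟩ : Fin n) then (1 : ℝ) else 0) := by
      intro j
      rw [hD]
      simp only [Fin.ext_iff]
      split_ifs <;> first | omega | norm_num
    simp [mulVec, dotProduct, h, Finset.sum_add_distrib]
  have hSu : IsUnit S.det := (Matrix.isUnit_iff_isUnit_det S).1 hS.isUnit
  have hDS : (D * S) *ᵥ (S⁻¹ *ᵥ (1 : Fin n → ℝ)) = 0 := by
    rw [mulVec_mulVec, Matrix.mul_assoc, Matrix.mul_nonsing_inv _ hSu, Matrix.mul_one, hD1]
  have hinv : ∀ M : Matrix (Fin (n - 1)) (Fin (n - 1)) ℝ, M⁻¹ * M * M⁻¹ = M⁻¹ := by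
    intro M
    by_cases h : IsUnit M.det
    · rw [Matrix.nonsing_inv_mul _ h, Matrix.one_mul]
    · rw [Matrix.nonsing_inv_apply_not_isUnit _ h]; simp
  refine ⟨?_, ?_, ?_, ?_⟩
  · rw [hP₁, Matrix.smul_mul, Matrix.mul_smul, vecMulVec_mul_vecMulVec, ← hc,
      vecMulVec_smul, smul_smul, smul_smul]
    congr 1
    by_cases h : c = 0
    · simp [h]
    · field_simp
  · calc P₂ * P₂ = Dᵀ * ((D * S * Dᵀ)⁻¹ * (D * S * Dᵀ) * (D * S * Dᵀ)⁻¹) * (D * S) := by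
          rw [hP₂]; simp only [Matrix.mul_assoc]
      _ = P₂ := by rw [hinv, hP₂]
  · rw [hP₁, hP₂, Matrix.smul_mul, Matrix.mul_assoc, vecMulVec_mul, ← vecMul_vecMul,
      vecMul_transpose, hD1]
    simp
  · rw [hP₁, hP₂, Matrix.mul_smul, Matrix.mul_assoc, mul_vecMulVec, mul_vecMulVec, hDS]
    simp
end

section
/- Let Σ be an n×n real symmetric positive definite matrix, let X be a real n×k matrix, let Y ∈ ℝⁿ, set c := 𝟙ᵀΣ⁻¹𝟙 and Ω := Σ⁻¹ − c⁻¹ · Σ⁻¹𝟙𝟙ᵀΣ⁻¹, and assume XᵀΩX is invertible. If b₀ ∈ ℝ and b₁ ∈ ℝᵏ satisfy the generalized least squares normal equations of the level model with intercept, namely 𝟙ᵀΣ⁻¹(Y − b₀𝟙 − Xb₁) = 0 and XᵀΣ⁻¹(Y − b₀𝟙 − Xb₁) = 0, then b₁ = (XᵀΩX)⁻¹XᵀΩY. -/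
open Matrix

/-- If `(b₀, b₁)` satisfies the GLS normal equations of the level model with intercept,
then the slope estimate is `b₁ = (XᵀΩX)⁻¹XᵀΩY` with
`Ω = Σ⁻¹ − c⁻¹ Σ⁻¹𝟙𝟙ᵀΣ⁻¹`, `c = 𝟙ᵀΣ⁻¹𝟙`. -/
theorem gls_slope_formula (n k : ℕ)
    (S : Matrix (Fin n) (Fin n) ℝ) (hS : S.PosDef)
    (X : Matrix (Fin n) (Fin k) ℝ) (Y : Fin n → ℝ)
    (c : ℝ) (hc : c = (1 : Fin n → ℝ) ⬝ᵥ (S⁻¹ *ᵥ (1 : Fin n → ℝ)))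
    (Ω : Matrix (Fin n) (Fin n) ℝ)
    (hΩ : Ω = S⁻¹ - c⁻¹ • vecMulVec (S⁻¹ *ᵥ (1 : Fin n → ℝ)) ((1 : Fin n → ℝ) ᵥ* S⁻¹))
    (hXΩX : IsUnit (Xᵀ * Ω * X).det)
    (b₀ : ℝ) (b₁ : Fin k → ℝ)
    (h1 : (1 : Fin n → ℝ) ⬝ᵥ (S⁻¹ *ᵥ (Y - b₀ • (1 : Fin n → ℝ) - X *ᵥ b₁)) = 0)
    (h2 : Xᵀ *ᵥ (S⁻¹ *ᵥ (Y - b₀ • (1 : Fin n → ℝ) - X *ᵥ b₁)) = 0) :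
    b₁ = ((Xᵀ * Ω * X)⁻¹ * (Xᵀ * Ω)) *ᵥ Y := by
  have hΩv : ∀ v : Fin n → ℝ, Ω *ᵥ v =
      S⁻¹ *ᵥ v - (c⁻¹ * ((1 : Fin n → ℝ) ⬝ᵥ (S⁻¹ *ᵥ v))) • (S⁻¹ *ᵥ (1 : Fin n → ℝ)) := by
    intro v
    rw [hΩ, sub_mulVec, smul_mulVec, vecMulVec_mulVec, ← dotProduct_mulVec, mul_smul]
    simp
  have hΩ1 : Ω *ᵥ (1 : Fin n → ℝ) = 0 := by
    rw [hΩv, ← hc]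
    by_cases h0 : (1 : Fin n → ℝ) = 0
    · rw [h0]; simp
    · have hpos : 0 < c := by
        rw [hc]
        simpa using hS.inv.dotProduct_mulVec_pos h0
      rw [inv_mul_cancel₀ hpos.ne', one_smul, sub_self]
  have hr := hΩv (Y - b₀ • (1 : Fin n → ℝ) - X *ᵥ b₁)
  rw [h1, mul_zero, zero_smul, sub_zero] at hr
  rw [← hr, mulVec_sub, mulVec_sub, mulVec_sub, mulVec_smul, hΩ1, smul_zero, sub_zero,
    sub_eq_zero] at h2
  rw [← mulVec_mulVec, ← mulVec_mulVec, h2, mulVec_mulVec, mulVec_mulVec, mulVec_mulVec,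
    Matrix.mul_assoc _ Xᵀ Ω, Matrix.mul_assoc _ (Xᵀ * Ω) X, nonsing_inv_mul _ hXΩX, one_mulVec]
end

section
/- (SURE for linear models.) Let n > p ≥ 1, let X be a real n×p matrix with XᵀX invertible, let β ∈ ℝᵖ, σ > 0, and let μ be the product Gaussian measure on ℝⁿ with mean vector Xβ and coordinate variance σ². Let H := X(XᵀX)⁻¹Xᵀ and for y ∈ ℝⁿ set σ̂²(y) := ‖y − Hy‖²/(n − p). Let a ∈ ℝⁿ and let S be a real n×n matrix, and set Ŷ(y) := a + Sy. Then ∫ (‖y − Ŷ(y)‖² + (2·trace(S) − n)·σ̂²(y)) dμ(y) = ∫ ‖Ŷ(y) − Xβ‖² dμ(y); i.e., δ₀(Y) := ‖Y − Ŷ(Y)‖² + (2·trace(S) − n)σ̂²(Y) is an unbiased estimator of the risk ‖Ŷ(Y) − Xβ‖². -/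
open Matrix MeasureTheory ProbabilityTheory

lemma sure_aux_one {n : ℕ} {Ω : Type*} [MeasurableSpace Ω] (μ : Measure Ω) [IsProbabilityMeasure μ]
    (z : Fin n → Ω → ℝ) (hz : ∀ j, MemLp (z j) 2 μ) (v : ℝ)
    (h0 : ∀ j, ∫ w, z j w ∂μ = 0)
    (h2 : ∀ j k, ∫ w, z j w * z k w ∂μ = if j = k then v else 0)
    (b : ℝ) (c : Fin n → ℝ) :
    Integrable (fun w => (b + ∑ j, c j * z j w) ^ 2) μ ∧
    ∫ w, (b + ∑ j, c j * z j w) ^ 2 ∂μ = b ^ 2 + v * ∑ j, c j ^ 2 := by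
  have hi : ∀ j, Integrable (z j) μ := fun j => (hz j).integrable (by norm_num)
  have hij : ∀ j k, Integrable (fun w => z j w * z k w) μ := fun j k =>
    (hz j).integrable_mul (hz k)
  have e : (fun w => (b + ∑ j, c j * z j w) ^ 2) = fun w =>
      (b ^ 2 + ∑ j, (2 * b * c j) * z j w) + ∑ j, ∑ k, (c j * c k) * (z j w * z k w) := by
    funext w
    have : (∑ j, c j * z j w) ^ 2 = ∑ j, ∑ k, (c j * c k) * (z j w * z k w) := by
      rw [sq, Finset.sum_mul_sum]
      refine Finset.sum_congr rfl fun j _ => Finset.sum_congr rfl fun k _ => by ring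
    rw [← this]
    have : ∑ j, (2 * b * c j) * z j w = 2 * b * ∑ j, c j * z j w := by
      rw [Finset.mul_sum]; refine Finset.sum_congr rfl fun j _ => by ring
    rw [this]; ring
  have i1 : Integrable (fun w => ∑ j, (2 * b * c j) * z j w) μ :=
    integrable_finsetSum _ fun j _ => (hi j).const_mul _
  have i2' : ∀ j, Integrable (fun w => ∑ k, (c j * c k) * (z j w * z k w)) μ := fun j =>
    integrable_finsetSum _ fun k _ => (hij j k).const_mul _
  have i2 : Integrable (fun w => ∑ j, ∑ k, (c j * c k) * (z j w * z k w)) μ :=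
    integrable_finsetSum _ fun j _ => i2' j
  have i3 : Integrable (fun w => b ^ 2 + ∑ j, (2 * b * c j) * z j w) μ :=
    (integrable_const _).add i1
  rw [e]
  refine ⟨i3.add i2, ?_⟩
  rw [integral_add i3 i2, integral_add (integrable_const _) i1,
    integral_finsetSum _ fun j _ => (hi j).const_mul _,
    integral_finsetSum _ fun j _ => i2' j]
  simp_rw [integral_finsetSum _ fun k _ => (hij _ k).const_mul _, integral_const_mul, h0, h2]
  simp [Finset.mul_sum]
  refine Finset.sum_congr rfl fun j _ => by ring

lemma sure_aux_sum {n : ℕ} {Ω : Type*} [MeasurableSpace Ω] (μ : Measure Ω) [IsProbabilityMeasure μ]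
    (z : Fin n → Ω → ℝ) (hz : ∀ j, MemLp (z j) 2 μ) (v : ℝ)
    (h0 : ∀ j, ∫ w, z j w ∂μ = 0)
    (h2 : ∀ j k, ∫ w, z j w * z k w ∂μ = if j = k then v else 0)
    (b : Fin n → ℝ) (M : Matrix (Fin n) (Fin n) ℝ) :
    Integrable (fun w => ∑ i, (b i + ∑ j, M i j * z j w) ^ 2) μ ∧
    ∫ w, ∑ i, (b i + ∑ j, M i j * z j w) ^ 2 ∂μ = ∑ i, b i ^ 2 + v * (M * Mᵀ).trace := by
  have h := fun i => sure_aux_one μ z hz v h0 h2 (b i) (M i)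
  refine ⟨integrable_finsetSum _ fun i _ => (h i).1, ?_⟩
  rw [integral_finsetSum _ fun i _ => (h i).1]
  simp_rw [fun i => (h i).2]
  rw [Finset.sum_add_distrib, ← Finset.mul_sum]
  simp [Matrix.trace, Matrix.mul_apply, sq]

/-- SURE for linear models: `δ₀(Y) = ‖Y − Ŷ(Y)‖² + (2 tr S − n) σ̂²(Y)` is an unbiased
estimator of the risk `‖Ŷ(Y) − Xβ‖²`, where `Ŷ(y) = a + Sy`, `Y ∼ N(Xβ, σ²Iₙ)` and
`σ̂²(y) = ‖y − Hy‖²/(n − p)` with hat matrix `H = X(XᵀX)⁻¹Xᵀ`. -/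
theorem sure_unbiased (n p : ℕ) (hp : 1 ≤ p) (hnp : p < n)
    (X : Matrix (Fin n) (Fin p) ℝ) (hX : IsUnit (Xᵀ * X).det)
    (β : Fin p → ℝ) (σ : ℝ) (hσ : 0 < σ)
    (μ : Measure (Fin n → ℝ))
    (hμ : μ = Measure.pi fun i => gaussianReal ((X *ᵥ β) i) ⟨σ ^ 2, sq_nonneg σ⟩)
    (a : Fin n → ℝ) (S : Matrix (Fin n) (Fin n) ℝ) :
    (∫ y, ((∑ i, (y i - (a + S *ᵥ y) i) ^ 2) +
        (2 * S.trace - n) *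
          ((∑ i, (y i - ((X * (Xᵀ * X)⁻¹ * Xᵀ) *ᵥ y) i) ^ 2) / ((n : ℝ) - p))) ∂μ)
      = ∫ y, ∑ i, ((a + S *ᵥ y) i - (X *ᵥ β) i) ^ 2 ∂μ := by
  obtain ⟨V, hV, hμ⟩ : ∃ V : NNReal, (V : ℝ) = σ ^ 2 ∧
      μ = Measure.pi fun i => gaussianReal ((X *ᵥ β) i) V := ⟨⟨σ ^ 2, sq_nonneg σ⟩, rfl, hμ⟩
  have hprob : IsProbabilityMeasure μ := by rw [hμ]; infer_instance
  set H := X * (Xᵀ * X)⁻¹ * Xᵀ with hH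
  set m := X *ᵥ β with hm
  have hHm : H *ᵥ m = m := by
    rw [hH, hm, Matrix.mulVec_mulVec, Matrix.mul_assoc, Matrix.mul_assoc,
      Matrix.nonsing_inv_mul _ hX, Matrix.mul_one]
  have hHT : Hᵀ = H := by
    rw [hH]
    simp [Matrix.transpose_mul, Matrix.transpose_nonsing_inv, Matrix.mul_assoc]
  have hHH : H * H = H := by
    have : H * X = X := by
      rw [hH, Matrix.mul_assoc, Matrix.mul_assoc, Matrix.nonsing_inv_mul _ hX, Matrix.mul_one]
    conv_lhs => rhs; rw [hH]
    rw [← Matrix.mul_assoc, ← Matrix.mul_assoc, this]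
  have hHtr : H.trace = p := by
    rw [hH, Matrix.mul_assoc, Matrix.trace_mul_comm, Matrix.mul_assoc,
      Matrix.nonsing_inv_mul _ hX]
    simp
  let z : Fin n → (Fin n → ℝ) → ℝ := fun j y => y j - m j
  have hg : ∀ j, MemLp (fun x : ℝ => x - m j) 2 (gaussianReal (m j) V) :=
    fun j => (memLp_id_gaussianReal 2).sub (memLp_const _)
  have hmp : ∀ j, MeasurePreserving (Function.eval j) μ
      (gaussianReal (m j) V) := fun j => by
    rw [hμ]
    exact measurePreserving_eval (fun i => gaussianReal (m i) V) j
  have hz : ∀ j, MemLp (z j) 2 μ := fun j => (hg j).comp_measurePreserving (hmp j)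
  have hint : ∀ j (f : ℝ → ℝ), Measurable f → ∫ y, f (y j) ∂μ =
      ∫ x, f x ∂(gaussianReal (m j) V) := fun j f hf => by
    rw [← (hmp j).map_eq, integral_map (hmp j).measurable.aemeasurable
      hf.aestronglyMeasurable]
  have h0 : ∀ j, ∫ y, z j y ∂μ = 0 := fun j => by
    rw [show (∫ y, z j y ∂μ) = _ from hint j (fun x => x - m j) (by fun_prop),
      integral_sub (f := fun x => x) ((memLp_id_gaussianReal 1).integrable (by norm_num)) (integrable_const _)]
    simp
  have h2 : ∀ j k, ∫ y, z j y * z k y ∂μ = if j = k then σ ^ 2 else 0 := fun j k => by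
    split_ifs with hjk
    · subst hjk
      have := variance_fun_id_gaussianReal (μ := m j) (v := V)
      rw [variance_eq_integral (by fun_prop), integral_id_gaussianReal, hV] at this
      rw [show (∫ y, z j y * z j y ∂μ) = _ from
        hint j (fun x => (x - m j) * (x - m j)) (by fun_prop)]
      simp_rw [← sq]
      exact this
    · have hI : iIndepFun (fun i (y : Fin n → ℝ) => y i - m i) μ := by
        rw [hμ]
        exact iIndepFun_pi (X := fun i (x : ℝ) => x - m i) (fun i => by fun_prop)
      have := (hI.indepFun hjk).integral_mul_eq_mul_integral
        (hz j).aestronglyMeasurable (hz k).aestronglyMeasurable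
      rw [show (∫ y, z j y * z k y ∂μ) = _ from this]
      rw [show (∫ y, y j - m j ∂μ) = 0 from h0 j, zero_mul]
  have key := sure_aux_sum μ z hz (σ ^ 2) h0 h2
  have mv : ∀ (M : Matrix (Fin n) (Fin n) ℝ) y i, ∑ j, M i j * z j y
      = (M *ᵥ y) i - (M *ᵥ m) i := fun M y i => by
    simp only [Matrix.mulVec, dotProduct, z, mul_sub, Finset.sum_sub_distrib]
  simp_rw [mv] at key
  have k1 := key (m - a - S *ᵥ m) (1 - S)
  have k2 := key 0 (1 - H)
  have k3 := key (a + S *ᵥ m - m) S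
  have e1 : ∀ y i, y i - (a + S *ᵥ y) i = (m - a - S *ᵥ m) i +
      (((1 - S) *ᵥ y) i - ((1 - S) *ᵥ m) i) := fun y i => by
    simp [Matrix.sub_mulVec]; ring
  have e2 : ∀ y i, y i - (H *ᵥ y) i = (0 : Fin n → ℝ) i +
      (((1 - H) *ᵥ y) i - ((1 - H) *ᵥ m) i) := fun y i => by
    simp [Matrix.sub_mulVec, hHm]
  have e3 : ∀ y i, (a + S *ᵥ y) i - m i = (a + S *ᵥ m - m) i +
      ((S *ᵥ y) i - (S *ᵥ m) i) := fun y i => by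
    simp; ring
  simp_rw [e1, e2, e3]
  rw [integral_add k1.1 ((k2.1.div_const _).const_mul _), integral_const_mul, integral_div,
    k1.2, k2.2, k3.2]
  have t1 : ((1 - S) * (1 - S)ᵀ).trace = (n : ℝ) - 2 * S.trace + (S * Sᵀ).trace := by
    simp [Matrix.mul_sub, Matrix.sub_mul, Matrix.trace_sub, Matrix.trace_transpose]; ring
  have t2 : ((1 - H) * (1 - H)ᵀ).trace = (n : ℝ) - (p : ℝ) := by
    simp [Matrix.mul_sub, Matrix.sub_mul, Matrix.trace_sub, hHT, hHH, hHtr]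
  have t3 : ∑ i, (m - a - S *ᵥ m) i ^ 2 = ∑ i, (a + S *ᵥ m - m) i ^ 2 :=
    Finset.sum_congr rfl fun i _ => by simp; ring
  have hne : (n : ℝ) - p ≠ 0 := by
    have : (p : ℝ) < n := by exact_mod_cast hnp
    linarith
  rw [t1, t2, t3]
  simp
  field_simp
  ring
end

section
/- Let n > p ≥ 1, let X be a real n×p matrix with XᵀX invertible, let β ∈ ℝᵖ, σ > 0, and let μ be the product Gaussian measure on ℝⁿ with mean vector Xβ and coordinate variance σ². With H := X(XᵀX)⁻¹Xᵀ, one has ∫ ‖y − Hy‖² dμ(y) = (n − p)·σ²; in particular σ̂²(y) := ‖y − Hy‖²/(n − p) is an unbiased estimator of σ². -/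
open Matrix MeasureTheory ProbabilityTheory

/-- `∫ ‖y − Hy‖² dμ = (n − p) σ²` for `μ = N(Xβ, σ²Iₙ)` and hat matrix
`H = X(XᵀX)⁻¹Xᵀ`; in particular `σ̂² = ‖y − Hy‖²/(n − p)` is unbiased for `σ²`. -/
theorem residual_variance_unbiased (n p : ℕ) (hp : 1 ≤ p) (hnp : p < n)
    (X : Matrix (Fin n) (Fin p) ℝ) (hX : IsUnit (Xᵀ * X).det)
    (β : Fin p → ℝ) (σ : ℝ) (hσ : 0 < σ)
    (μ : Measure (Fin n → ℝ))
    (hμ : μ = Measure.pi fun i => gaussianReal ((X *ᵥ β) i) ⟨σ ^ 2, sq_nonneg σ⟩) :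
    (∫ y, ∑ i, (y i - ((X * (Xᵀ * X)⁻¹ * Xᵀ) *ᵥ y) i) ^ 2 ∂μ)
      = ((n : ℝ) - p) * σ ^ 2 := by
  obtain ⟨v, hv, hμ⟩ : ∃ v : NNReal, (v : ℝ) = σ ^ 2 ∧
      μ = Measure.pi fun i => gaussianReal ((X *ᵥ β) i) v :=
    ⟨⟨σ ^ 2, sq_nonneg σ⟩, rfl, hμ⟩
  set H := X * (Xᵀ * X)⁻¹ * Xᵀ with hH
  have hHX : H * X = X := by
    rw [hH, Matrix.mul_assoc, Matrix.mul_assoc, Matrix.nonsing_inv_mul _ hX, Matrix.mul_one]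
  have hHT : Hᵀ = H := by
    simp [hH, Matrix.transpose_mul, Matrix.transpose_nonsing_inv, Matrix.mul_assoc]
  have hHH : H * H = H := by
    conv_lhs => rhs; rw [hH]
    rw [← Matrix.mul_assoc, ← Matrix.mul_assoc, hHX]
  have htr : H.trace = p := by
    rw [hH, Matrix.trace_mul_comm, ← Matrix.mul_assoc, Matrix.mul_nonsing_inv _ hX]
    simp
  obtain ⟨M, hM⟩ : ∃ M, M = 1 - H := ⟨_, rfl⟩
  have hMM : M * Mᵀ = M := by
    rw [hM, Matrix.transpose_sub, hHT, Matrix.transpose_one, Matrix.sub_mul, Matrix.mul_sub,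
      Matrix.mul_sub, hHH]
    simp
  have hMtr : M.trace = (n : ℝ) - p := by
    rw [hM, Matrix.trace_sub, htr]; simp
  have hMX : M *ᵥ (X *ᵥ β) = 0 := by
    rw [Matrix.mulVec_mulVec, hM, Matrix.sub_mul, hHX]; simp
  have hres : ∀ (y : Fin n → ℝ) i, y i - (H *ᵥ y) i = ∑ j, M i j * y j := by
    intro y i
    have : (M *ᵥ y) i = y i - (H *ᵥ y) i := by
      rw [hM, Matrix.sub_mulVec]; simp
    rw [← this]; rfl
  simp_rw [hres]
  have hL : ∀ i j, MemLp (fun x : ℝ => M i j * x) 2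
      (gaussianReal ((X *ᵥ β) j) v) := fun i j =>
    (memLp_id_gaussianReal' 2 (by simp)).const_mul (M i j)
  have hLμ : ∀ i j, MemLp (fun y : Fin n → ℝ => M i j * y j) 2 μ := by
    intro i j
    rw [hμ]
    exact (hL i j).comp_measurePreserving (measurePreserving_eval _ j)
  have hprob : IsProbabilityMeasure μ := by rw [hμ]; infer_instance
  have hS : ∀ i, MemLp (fun y : Fin n → ℝ => ∑ j, M i j * y j) 2 μ := fun i =>
    memLp_finsetSum _ fun j _ => hLμ i j
  rw [integral_finsetSum _ fun i _ => (hS i).integrable_sq]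
  have hmean : ∀ i, ∫ y, ∑ j, M i j * y j ∂μ = 0 := by
    intro i
    rw [integral_finsetSum _ fun j _ => (hLμ i j).integrable (by norm_num)]
    have : ∀ j, ∫ y, M i j * y j ∂μ = M i j * (X *ᵥ β) j := by
      intro j
      rw [integral_const_mul, hμ, integral_eval]
      rw [integral_id_gaussianReal]
    simp_rw [this]
    exact congrFun hMX i
  have hvar : ∀ i, ∫ y, (∑ j, M i j * y j) ^ 2 ∂μ = σ ^ 2 * M i i := by
    intro i
    rw [← variance_of_integral_eq_zero (hS i).aestronglyMeasurable.aemeasurable (hmean i), hμ]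
    have := variance_sum_pi (hL i)
    have e : (fun y : Fin n → ℝ => ∑ j, M i j * y j) =
      ∑ j, fun y : Fin n → ℝ => M i j * y j := by ext y; simp
    rw [e, this]
    have hv1 : ∀ j, Var[fun x : ℝ => M i j * x; gaussianReal ((X *ᵥ β) j) v]
        = M i j ^ 2 * v := by
      intro j
      rw [variance_const_mul (M i j) (fun x : ℝ => x), variance_fun_id_gaussianReal]
    rw [Finset.sum_congr rfl fun j _ => hv1 j]
    conv_rhs => rw [← hMM]
    rw [Matrix.mul_apply, Finset.mul_sum]
    refine Finset.sum_congr rfl fun j _ => ?_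
    rw [Matrix.transpose_apply]
    rw [hv]
    ring
  simp_rw [hvar]
  rw [← Finset.mul_sum, ← hMtr, mul_comm]
  rfl
end

section
/- Let n ≥ 1, m ∈ ℝⁿ, σ > 0, and let μ be the product Gaussian measure on ℝⁿ with mean vector m and coordinate variance σ². For any a ∈ ℝⁿ and any real n×n matrix S, ∫ ‖a + Sy − m‖² dμ(y) − ∫ ‖y − (a + Sy)‖² dμ(y) = (2·trace(S) − n)·σ². -/
open Matrix MeasureTheory ProbabilityTheory

theorem risk_aux (n : ℕ)
    (m : Fin n → ℝ) (σ : ℝ) (v : NNReal) (hv : (v : ℝ) = σ ^ 2)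
    (μ : Measure (Fin n → ℝ))
    (hμ : μ = Measure.pi fun i => gaussianReal (m i) v)
    (a : Fin n → ℝ) (S : Matrix (Fin n) (Fin n) ℝ) :
    (∫ y, ∑ i, ((a + S *ᵥ y) i - m i) ^ 2 ∂μ)
        - (∫ y, ∑ i, (y i - (a + S *ᵥ y) i) ^ 2 ∂μ)
      = (2 * S.trace - n) * σ ^ 2 := by
  have hprob : IsProbabilityMeasure μ := by rw [hμ]; infer_instance
  have hmp : ∀ i, MeasurePreserving (Function.eval i) μ
      (gaussianReal (m i) v) := by
    intro i; rw [hμ]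
    exact measurePreserving_eval (fun i => gaussianReal (m i) v) i
  have hL : ∀ i, MemLp (fun y : Fin n → ℝ => y i) 2 μ := fun i =>
    (memLp_id_gaussianReal' (μ := m i) (v := v) 2
      (by simp)).comp_measurePreserving (hmp i)
  have hz : ∀ i, MemLp (fun y : Fin n → ℝ => y i - m i) 2 μ := fun i =>
    (hL i).sub (memLp_const _)
  have hmean : ∀ i, ∫ y, y i ∂μ = m i := by
    intro i
    rw [← integral_id_gaussianReal (μ := m i) (v := v), ← (hmp i).map_eq,
      integral_map (measurable_pi_apply i).aemeasurable (by fun_prop)]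
  have hz0 : ∀ i, ∫ y, (y i - m i) ∂μ = 0 := by
    intro i
    rw [integral_sub ((hL i).integrable (by norm_num)) (integrable_const _), hmean]
    simp
  have hz2 : ∀ i, ∫ y, (y i - m i) * (y i - m i) ∂μ = σ ^ 2 := by
    intro i
    have h := variance_fun_id_gaussianReal (μ := m i) (v := v)
    rw [variance_eq_integral (by fun_prop), integral_id_gaussianReal, ← (hmp i).map_eq,
      integral_map (measurable_pi_apply i).aemeasurable (by fun_prop)] at h
    simp only [← pow_two]
    exact h.trans hv
  have hind : iIndepFun (fun i (y : Fin n → ℝ) => y i) μ := by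
    rw [hμ]
    exact iIndepFun_pi (X := fun _ x => x) (fun i => by fun_prop)
  have hzz : ∀ i j, i ≠ j → ∫ y, (y i - m i) * (y j - m j) ∂μ = 0 := by
    intro i j hij
    have h := (hind.indepFun hij).comp (φ := fun x => x - m i) (ψ := fun x => x - m j)
      (by fun_prop) (by fun_prop)
    have := h.integral_fun_mul_eq_mul_integral
      (hz i).aestronglyMeasurable (hz j).aestronglyMeasurable
    simp only [Function.comp_apply] at this
    rw [this, hz0, zero_mul]
  have hI : ∀ i j, Integrable (fun y : Fin n → ℝ => (y i - m i) * (y j - m j)) μ :=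
    fun i j => (hz i).integrable_mul (hz j)
  have hg : ∀ i, MemLp (fun y : Fin n → ℝ => (a + S *ᵥ y) i) 2 μ := by
    intro i
    simp only [Pi.add_apply, mulVec, dotProduct]
    have h1 : MemLp (fun y : Fin n → ℝ => ∑ j, S i j * y j) 2 μ :=
      memLp_finsetSum _ fun j _ => (hL j).const_mul _
    have h2 : MemLp (fun _ : Fin n → ℝ => a i) 2 μ := memLp_const _
    exact h2.add h1
  have hA : Integrable (fun y : Fin n → ℝ => ∑ i, ((a + S *ᵥ y) i - m i) ^ 2) μ :=
    integrable_finsetSum _ fun i _ => ((hg i).sub (memLp_const (m i))).integrable_sq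
  have hB : Integrable (fun y : Fin n → ℝ => ∑ i, (y i - (a + S *ᵥ y) i) ^ 2) μ :=
    integrable_finsetSum _ fun i _ => ((hL i).sub (hg i)).integrable_sq
  rw [← integral_sub hA hB]
  have key : ∀ y : Fin n → ℝ, ∑ i, ((a + S *ᵥ y) i - m i) ^ 2
      - ∑ i, (y i - (a + S *ᵥ y) i) ^ 2
      = ∑ i, (2 * (a i + (S *ᵥ m) i - m i) * (y i - m i)
        + ∑ j, 2 * S i j * ((y i - m i) * (y j - m j)) - (y i - m i) * (y i - m i)) := by
    intro y
    rw [← Finset.sum_sub_distrib]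
    refine Finset.sum_congr rfl fun i _ => ?_
    have : ∑ j, 2 * S i j * ((y i - m i) * (y j - m j))
        = 2 * (y i - m i) * ((S *ᵥ y) i - (S *ᵥ m) i) := by
      simp only [mulVec, dotProduct]
      rw [← Finset.sum_sub_distrib, Finset.mul_sum]
      exact Finset.sum_congr rfl fun j _ => by ring
    rw [this, Pi.add_apply]
    ring
  simp only [key]
  have hI1 : ∀ i, Integrable (fun y : Fin n → ℝ =>
      2 * (a i + (S *ᵥ m) i - m i) * (y i - m i)) μ :=
    fun i => ((hz i).integrable (by norm_num)).const_mul _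
  have hI2 : ∀ i, Integrable (fun y : Fin n → ℝ =>
      ∑ j, 2 * S i j * ((y i - m i) * (y j - m j))) μ :=
    fun i => integrable_finsetSum _ fun j _ => (hI i j).const_mul _
  have hI12 : ∀ i, Integrable (fun y : Fin n → ℝ =>
      2 * (a i + (S *ᵥ m) i - m i) * (y i - m i)
        + ∑ j, 2 * S i j * ((y i - m i) * (y j - m j))) μ :=
    fun i => (hI1 i).add (hI2 i)
  have hI3 : ∀ i, Integrable (fun y : Fin n → ℝ =>
      2 * (a i + (S *ᵥ m) i - m i) * (y i - m i)
        + ∑ j, 2 * S i j * ((y i - m i) * (y j - m j)) - (y i - m i) * (y i - m i)) μ :=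
    fun i => (hI12 i).sub (hI i i)
  rw [integral_finsetSum _ fun i _ => hI3 i]
  have hterm : ∀ i, ∫ y, (2 * (a i + (S *ᵥ m) i - m i) * (y i - m i)
        + ∑ j, 2 * S i j * ((y i - m i) * (y j - m j)) - (y i - m i) * (y i - m i)) ∂μ
      = (2 * S i i - 1) * σ ^ 2 := by
    intro i
    rw [integral_sub (hI12 i) (hI i i), integral_add (hI1 i) (hI2 i),
      integral_finsetSum _ fun j _ => (hI i j).const_mul _, integral_const_mul, hz0, hz2,
      Finset.sum_eq_single i]
    · rw [integral_const_mul, hz2]; ring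
    · intro j _ hj
      rw [integral_const_mul, hzz i j hj.symm, mul_zero]
    · simp
  simp only [hterm]
  rw [← Finset.sum_mul, Finset.sum_sub_distrib, ← Finset.mul_sum]
  simp [Matrix.trace]

/-- For `μ = N(m, σ²Iₙ)`, any `a ∈ ℝⁿ` and any `n×n` matrix `S`,
`∫ ‖a + Sy − m‖² dμ − ∫ ‖y − (a + Sy)‖² dμ = (2 tr S − n) σ²`. -/
theorem gaussian_risk_difference (n : ℕ) (hn : 1 ≤ n)
    (m : Fin n → ℝ) (σ : ℝ) (hσ : 0 < σ)
    (μ : Measure (Fin n → ℝ))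
    (hμ : μ = Measure.pi fun i => gaussianReal (m i) ⟨σ ^ 2, sq_nonneg σ⟩)
    (a : Fin n → ℝ) (S : Matrix (Fin n) (Fin n) ℝ) :
    (∫ y, ∑ i, ((a + S *ᵥ y) i - m i) ^ 2 ∂μ)
        - (∫ y, ∑ i, (y i - (a + S *ᵥ y) i) ^ 2 ∂μ)
      = (2 * S.trace - n) * σ ^ 2 := by
  exact risk_aux n m σ ⟨σ ^ 2, sq_nonneg σ⟩ rfl μ hμ a S
end

section
/- (SURE minimization with respect to g.) Let n > p ≥ 1, let X be a real n×p matrix with XᵀX invertible, H := X(XᵀX)⁻¹Xᵀ, Y ∈ ℝⁿ, β₀ ∈ ℝᵖ, Y₀ := Xβ₀, Ŷ_OLS := HY, and σ̂² := ‖Y − HY‖²/(n − p). For g > 0 define the SURE criterion δ(g) := ‖Y − ((1/(1+g))·Y₀ + (g/(1+g))·Ŷ_OLS)‖² + (2p·g/(1+g) − n)·σ̂². Assume σ̂² > 0 and ‖Ŷ_OLS − Y₀‖² > p·σ̂², and set g⋆ := ‖Ŷ_OLS − Y₀‖²/(p·σ̂²) − 1. Then g⋆ > 0 and δ(g⋆)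 ≤ δ(g) for every g > 0; i.e., g⋆ minimizes SURE over g > 0. -/
open Matrix

/-- SURE minimization with respect to `g`: under `σ̂² > 0` and
`‖Ŷ_OLS − Y₀‖² > p σ̂²`, the value `g⋆ = ‖Ŷ_OLS − Y₀‖²/(p σ̂²) − 1` is positive and
minimizes the SURE criterion `δ(g)` over `g > 0`. -/
theorem sure_minimizer (n p : ℕ) (hp : 1 ≤ p) (hnp : p < n)
    (X : Matrix (Fin n) (Fin p) ℝ) (hX : IsUnit (Xᵀ * X).det)
    (Y : Fin n → ℝ) (β₀ : Fin p → ℝ)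
    (Y₀ Yols : Fin n → ℝ) (hY₀ : Y₀ = X *ᵥ β₀)
    (hYols : Yols = (X * (Xᵀ * X)⁻¹ * Xᵀ) *ᵥ Y)
    (s2 : ℝ) (hs2def : s2 = (∑ i, (Y i - Yols i) ^ 2) / ((n : ℝ) - p))
    (hs2 : 0 < s2) (hA : (p : ℝ) * s2 < ∑ i, (Yols i - Y₀ i) ^ 2)
    (δ : ℝ → ℝ)
    (hδ : ∀ g, δ g = (∑ i, (Y i - ((1 / (1 + g)) • Y₀ + (g / (1 + g)) • Yols) i) ^ 2)
        + (2 * p * g / (1 + g) - n) * s2)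
    (gstar : ℝ) (hgstar : gstar = (∑ i, (Yols i - Y₀ i) ^ 2) / ((p : ℝ) * s2) - 1) :
    0 < gstar ∧ ∀ g > 0, δ gstar ≤ δ g := by
  have hcross : ∑ i, (Y i - Yols i) * (Yols i - Y₀ i) = 0 := by
    have h0 : Xᵀ *ᵥ (Y - Yols) = 0 := by
      have h1 : Xᵀ * (X * (Xᵀ * X)⁻¹ * Xᵀ) = Xᵀ := by
        rw [← Matrix.mul_assoc, ← Matrix.mul_assoc, Matrix.mul_nonsing_inv _ hX, Matrix.one_mul]
      rw [hYols, Matrix.mulVec_sub, Matrix.mulVec_mulVec, h1, sub_self]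
    have h2 : Yols - Y₀ = X *ᵥ (((Xᵀ * X)⁻¹ * Xᵀ) *ᵥ Y - β₀) := by
      rw [hYols, hY₀, Matrix.mulVec_sub, Matrix.mulVec_mulVec, Matrix.mul_assoc]
    have h3 : (Y - Yols) ⬝ᵥ (Yols - Y₀) = 0 := by
      rw [h2, Matrix.dotProduct_mulVec, ← Matrix.mulVec_transpose, h0, zero_dotProduct]
    simpa [dotProduct] using h3
  have hp' : (0 : ℝ) < p := by exact_mod_cast hp
  have hps : 0 < (p : ℝ) * s2 := mul_pos hp' hs2
  have key : ∀ g : ℝ, 0 < g → δ g = (∑ i, (Y i - Yols i) ^ 2)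
      + (1 / (1 + g)) ^ 2 * (∑ i, (Yols i - Y₀ i) ^ 2)
      + (2 * p * (1 - 1 / (1 + g)) - n) * s2 := by
    intro g hg
    have hg1 : 1 + g ≠ 0 := by positivity
    have e : g / (1 + g) = 1 - 1 / (1 + g) := by field_simp; ring
    rw [hδ, mul_div_assoc, e]
    generalize 1 / (1 + g) = t
    have : ∑ i, (Y i - (t • Y₀ + (1 - t) • Yols) i) ^ 2 = (∑ i, (Y i - Yols i) ^ 2)
        + t ^ 2 * (∑ i, (Yols i - Y₀ i) ^ 2)
        + 2 * t * ∑ i, (Y i - Yols i) * (Yols i - Y₀ i) := by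
      rw [Finset.mul_sum, Finset.mul_sum, ← Finset.sum_add_distrib, ← Finset.sum_add_distrib]
      refine Finset.sum_congr rfl fun i _ => ?_
      simp only [Pi.add_apply, Pi.smul_apply, smul_eq_mul]
      ring
    rw [this, hcross]
    ring
  have hg0 : 0 < gstar := by
    rw [hgstar, sub_pos, lt_div_iff₀ hps, one_mul]
    exact hA
  refine ⟨hg0, fun g hg => ?_⟩
  rw [key _ hg0, key _ hg]
  generalize (∑ i, (Yols i - Y₀ i) ^ 2) = A at *
  have hA0 : 0 < A := hps.trans hA
  have ht : 1 / (1 + gstar) * A = p * s2 := by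
    rw [hgstar]
    have : 1 + (A / (p * s2) - 1) = A / (p * s2) := by ring
    rw [this, one_div_div]
    field_simp
  generalize 1 / (1 + gstar) = u at *
  generalize 1 / (1 + g) = t at *
  have h5 : 0 ≤ A * (t - u) ^ 2 := by positivity
  linear_combination h5 + 2 * (u - t) * ht
end

section
/- (Bayes factor for the Zellner g-prior against the null model.) Let n ≥ 2, let X be a real n×p matrix whose columns are centered (Xᵀ𝟙 = 0) with M := XᵀX invertible, let g > 0 and y ∈ ℝⁿ. Let ȳ := (1/n)·𝟙ᵀy, y_c := y − ȳ𝟙, H := XM⁻¹Xᵀ, and assume y_c ≠ 0; define R² := (y_cᵀHy_c)/‖y_c‖². Define the marginal likelihoods m_γ := ∫_ℝ ∫_{(0,∞)} ∫_{ℝᵖ} (2πσ²)^{−n/2} exp(−‖y − α𝟙 − Xβ‖²/(2σ²)) · (2πgσ²)^{−p/2}(det M)^{1/2} exp(−βᵀMβ/(2gσ²)) dβ · (σ²)^{−1} dσ² dα and m_N := ∫_ℝ ∫_{(0,∞)} (2πσ²)^{−n/2} exp(−‖y − α𝟙‖²/(2σ²)) · (σ²)^{−1} dσ² dα. Then both integrals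 are finite and positive, and m_γ / m_N = (1+g)^{(n−p−1)/2} · (1 + g(1 − R²))^{−(n−1)/2}. -/
open Matrix MeasureTheory

lemma invgamma (k C : ℝ) (hk : 0 < k) (hC : 0 < C) :
    ∫⁻ s in Set.Ioi (0:ℝ), ENNReal.ofReal (s ^ (-k-1) * Real.exp (-(C/s)))
      = ENNReal.ofReal ((1/C)^k * Real.Gamma k) := by
  have h1 : ∫ s in Set.Ioi (0:ℝ), (s ^ (-k-1) * Real.exp (-(C/s))) = (1/C)^k * Real.Gamma k := by
    rw [← Real.integral_rpow_mul_exp_neg_mul_Ioi hk hC,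
      ← integral_comp_rpow_Ioi (fun t => t ^ (k - 1) * Real.exp (-(C * t))) (p := -1) (by norm_num)]
    refine setIntegral_congr_fun measurableSet_Ioi (fun s hs => ?_)
    have hs : 0 < s := hs
    simp only [smul_eq_mul, abs_neg, abs_one, one_mul]
    rw [← Real.rpow_mul hs.le, ← mul_assoc, ← Real.rpow_add hs, Real.rpow_neg_one, div_eq_mul_inv]
    congr 2
    ring
  have h0 : 0 < (1/C)^k * Real.Gamma k := mul_pos (by positivity) (Real.Gamma_pos_of_pos hk)
  rw [← h1, ofReal_integral_eq_lintegral_ofReal]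
  · exact .of_integral_ne_zero (by rw [h1]; exact h0.ne')
  · refine (ae_restrict_iff' measurableSet_Ioi).mpr (ae_of_all _ fun s hs => ?_)
    have hs : 0 < s := hs
    simp only [Pi.zero_apply]; positivity

lemma gauss1 (b m : ℝ) (hb : 0 < b) :
    ∫⁻ a : ℝ, ENNReal.ofReal (Real.exp (-b * (a - m)^2)) = ENNReal.ofReal (√(Real.pi / b)) := by
  rw [lintegral_sub_right_eq_self (fun a => ENNReal.ofReal (Real.exp (-b * a^2))),
    ← integral_gaussian, ofReal_integral_eq_lintegral_ofReal (integrable_exp_neg_mul_sq hb)]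
  exact ae_of_all _ fun s => by simp only [Pi.zero_apply]; positivity

lemma gaussp {p : ℕ} (b : ℝ) (hb : 0 < b) :
    ∫⁻ u : Fin p → ℝ, ENNReal.ofReal (Real.exp (-b * (u ⬝ᵥ u)))
      = ENNReal.ofReal ((Real.pi / b) ^ ((p:ℝ)/2)) := by
  have h1 : ∫ u : Fin p → ℝ, (Real.exp (-b * (u ⬝ᵥ u))) = (Real.pi / b) ^ ((p:ℝ)/2) := by
    have : ∀ u : Fin p → ℝ, Real.exp (-b * (u ⬝ᵥ u)) = ∏ i, Real.exp (-b * (u i)^2) := by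
      intro u
      rw [← Real.exp_sum, dotProduct, Finset.mul_sum]
      congr 1
      exact Finset.sum_congr rfl fun i _ => by ring
    simp_rw [this]
    rw [integral_fintype_prod_volume_eq_pow (fun x : ℝ => Real.exp (-b * x^2)), integral_gaussian,
      Real.sqrt_eq_rpow, ← Real.rpow_natCast, ← Real.rpow_mul (by positivity)]
    congr 1
    simp; ring
  have h0 : 0 < (Real.pi / b) ^ ((p:ℝ)/2) := by positivity
  rw [← h1, ofReal_integral_eq_lintegral_ofReal]
  · exact .of_integral_ne_zero (by rw [h1]; exact h0.ne')
  · exact ae_of_all _ fun s => by simp only [Pi.zero_apply]; positivity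

open scoped MatrixOrder in
lemma exists_sqrt {p : ℕ} (M : Matrix (Fin p) (Fin p) ℝ) (hM : M.PosSemidef) :
    ∃ B : Matrix (Fin p) (Fin p) ℝ, M = Bᵀ * B := by
  obtain ⟨B, hB⟩ := CStarAlgebra.nonneg_iff_eq_star_mul_self.mp hM.nonneg
  exact ⟨B, by simpa [star_eq_conjTranspose, conjTranspose_eq_transpose_of_trivial] using hB⟩

lemma gaussM {p : ℕ} (M : Matrix (Fin p) (Fin p) ℝ) (hM : M.PosDef) (b : ℝ) (hb : 0 < b)
    (m : Fin p → ℝ) :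
    ∫⁻ u : Fin p → ℝ, ENNReal.ofReal (Real.exp (-b * ((u - m) ⬝ᵥ (M *ᵥ (u - m)))))
      = ENNReal.ofReal ((Real.pi / b) ^ ((p:ℝ)/2) * M.det ^ (-(1:ℝ)/2)) := by
  rw [lintegral_sub_right_eq_self
    (fun u : Fin p → ℝ => ENNReal.ofReal (Real.exp (-b * (u ⬝ᵥ (M *ᵥ u)))))]
  obtain ⟨B, hB⟩ := exists_sqrt M hM.posSemidef
  have hd : M.det = B.det ^ 2 := by rw [hB, det_mul, det_transpose]; ring
  have hpos := hM.det_pos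
  have hBd : B.det ≠ 0 := by
    intro h; rw [hd, h] at hpos; simp at hpos
  have e : ∀ u : Fin p → ℝ, u ⬝ᵥ (M *ᵥ u) = (toLin' B u) ⬝ᵥ (toLin' B u) := by
    intro u
    rw [toLin'_apply, hB, ← mulVec_mulVec, dotProduct_mulVec, vecMul_transpose]
  simp_rw [e]
  have hmeas : Measurable (fun u : Fin p → ℝ => ENNReal.ofReal (Real.exp (-b * (u ⬝ᵥ u)))) := by
    apply Measurable.ennreal_ofReal
    apply Continuous.measurable
    fun_prop
  have hm2 : Measurable (toLin' B) := (LinearMap.continuous_of_finiteDimensional _).measurable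
  rw [← lintegral_map hmeas hm2, Real.map_matrix_volume_pi_eq_smul_volume_pi hBd,
    lintegral_smul_measure, gaussp b hb, smul_eq_mul, ← ENNReal.ofReal_mul (by positivity), mul_comm]
  congr 2
  rw [hd, ← sq_abs, ← Real.rpow_natCast, ← Real.rpow_mul (by positivity), abs_inv,
    ← Real.rpow_neg_one]
  congr 1
  norm_num

lemma marg (n : ℕ) (hn : 2 ≤ n) : ∃ K : ℝ, 0 < K ∧ ∀ (m T : ℝ), 0 < T →
    ∫⁻ a : ℝ, ∫⁻ s in Set.Ioi (0 : ℝ),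
        ENNReal.ofReal ((2 * Real.pi * s) ^ (-(n : ℝ) / 2)
          * Real.exp (-(n * (a - m) ^ 2 + T) / (2 * s)) * s⁻¹)
      = ENNReal.ofReal (K * T ^ (-((n : ℝ) - 1) / 2)) := by
  have hn' : (2:ℝ) ≤ n := by exact_mod_cast hn
  have hk : 0 < ((n:ℝ) - 1)/2 := by linarith
  have hG := Real.Gamma_pos_of_pos hk
  have hpi := Real.pi_pos
  refine ⟨(2 * Real.pi) ^ (-(n : ℝ) / 2) * √(2 * Real.pi / n) * (2:ℝ) ^ (((n:ℝ) - 1)/2)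
    * Real.Gamma (((n:ℝ) - 1)/2), by positivity, fun m T hT => ?_⟩
  rw [lintegral_lintegral_swap]
  swap
  · apply Measurable.aemeasurable
    apply Measurable.ennreal_ofReal
    fun_prop
  have h1 : ∀ s ∈ Set.Ioi (0:ℝ), ∫⁻ a : ℝ, ENNReal.ofReal ((2 * Real.pi * s) ^ (-(n : ℝ) / 2)
          * Real.exp (-(n * (a - m) ^ 2 + T) / (2 * s)) * s⁻¹)
      = ENNReal.ofReal ((2 * Real.pi) ^ (-(n : ℝ) / 2) * √(2 * Real.pi / n)) *
        ENNReal.ofReal (s ^ (-(((n:ℝ) - 1)/2) - 1) * Real.exp (-((T/2)/s))) := by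
    intro s hs
    have hs : 0 < s := hs
    have e : ∀ a : ℝ, ENNReal.ofReal ((2 * Real.pi * s) ^ (-(n : ℝ) / 2)
          * Real.exp (-(n * (a - m) ^ 2 + T) / (2 * s)) * s⁻¹)
        = ENNReal.ofReal ((2 * Real.pi * s) ^ (-(n : ℝ) / 2) * s⁻¹ * Real.exp (-((T/2)/s))) *
          ENNReal.ofReal (Real.exp (-(n / (2 * s)) * (a - m)^2)) := by
      intro a
      rw [← ENNReal.ofReal_mul (by positivity), mul_assoc _ (Real.exp _) (Real.exp _),
        ← Real.exp_add, mul_right_comm]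
      congr 3
      field_simp
      ring
    simp_rw [e]
    rw [lintegral_const_mul' _ _ ENNReal.ofReal_ne_top, gauss1 _ _ (by positivity),
      ← ENNReal.ofReal_mul (by positivity), ← ENNReal.ofReal_mul (by positivity)]
    congr 1
    have e2 : Real.pi / (n / (2 * s)) = (2 * Real.pi / n) * s := by field_simp
    have e3 : s ^ (-(((n:ℝ) - 1)/2) - 1) = s ^ (-(n:ℝ)/2) * s⁻¹ * √s := by
      rw [Real.sqrt_eq_rpow, ← Real.rpow_neg_one, ← Real.rpow_add hs, ← Real.rpow_add hs]
      congr 1; ring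
    rw [e2, e3, Real.sqrt_mul (by positivity), Real.mul_rpow (by positivity) hs.le]
    ring
  rw [setLIntegral_congr_fun measurableSet_Ioi h1,
    lintegral_const_mul' _ _ ENNReal.ofReal_ne_top, invgamma _ _ hk (by positivity),
    ← ENNReal.ofReal_mul (by positivity)]
  congr 1
  rw [show 1 / (T/2) = 2 * T⁻¹ by field_simp,
    Real.mul_rpow (x := 2) (y := T⁻¹) (by positivity) (by positivity),
    Real.inv_rpow hT.le, ← Real.rpow_neg hT.le, show -((n:ℝ) - 1)/2 = -(((n:ℝ) - 1)/2) by ring]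
  ring

lemma sum_shift {n : ℕ} (r : Fin n → ℝ) (h : ∑ i, r i = 0) (c : ℝ) :
    ∑ i, (r i + c) ^ 2 = n * c ^ 2 + ∑ i, (r i) ^ 2 := by
  have : ∀ i, (r i + c)^2 = r i ^ 2 + 2 * c * r i + c ^ 2 := fun i => by ring
  simp_rw [this, Finset.sum_add_distrib, ← Finset.mul_sum, h]
  simp; ring

lemma complete_sq {n p : ℕ} (X : Matrix (Fin n) (Fin p) ℝ) (hM : IsUnit (Xᵀ * X).det)
    (g : ℝ) (hg : 0 < g) (v : Fin n → ℝ) (β w : Fin p → ℝ)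
    (hw : w = (Xᵀ * X)⁻¹ *ᵥ (Xᵀ *ᵥ v)) :
    ∑ i, (v i - (X *ᵥ β) i) ^ 2 + (β ⬝ᵥ ((Xᵀ * X) *ᵥ β)) / g
      = (1 + g) / g * ((β - (g / (1 + g)) • w) ⬝ᵥ ((Xᵀ * X) *ᵥ (β - (g / (1 + g)) • w)))
        + (∑ i, (v i) ^ 2 - g / (1 + g) * (v ⬝ᵥ ((X * (Xᵀ * X)⁻¹ * Xᵀ) *ᵥ v))) := by
  have hMw : (Xᵀ * X) *ᵥ w = Xᵀ *ᵥ v := by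
    rw [hw, mulVec_mulVec, mul_nonsing_inv _ hM, one_mulVec]
  have hq : ∀ a b : Fin p → ℝ, a ⬝ᵥ ((Xᵀ * X) *ᵥ b) = (X *ᵥ a) ⬝ᵥ (X *ᵥ b) := by
    intro a b
    rw [← mulVec_mulVec, dotProduct_mulVec, vecMul_transpose]
  have hQ : v ⬝ᵥ ((X * (Xᵀ * X)⁻¹ * Xᵀ) *ᵥ v) = v ⬝ᵥ (X *ᵥ w) := by
    rw [hw, mulVec_mulVec, mulVec_mulVec, Matrix.mul_assoc]
  have hv : ∀ a : Fin p → ℝ, (X *ᵥ a) ⬝ᵥ (X *ᵥ w) = v ⬝ᵥ (X *ᵥ a) := by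
    intro a
    rw [← hq, hMw, dotProduct_mulVec, vecMul_transpose, dotProduct_comm]
  have e1 : ∑ i, (v i - (X *ᵥ β) i) ^ 2
      = ∑ i, (v i)^2 - 2 * (v ⬝ᵥ (X *ᵥ β)) + (X *ᵥ β) ⬝ᵥ (X *ᵥ β) := by
    simp only [dotProduct, Finset.mul_sum]
    rw [← Finset.sum_sub_distrib, ← Finset.sum_add_distrib]
    exact Finset.sum_congr rfl fun i _ => by ring
  rw [hQ, hq, hq, e1, mulVec_sub, mulVec_smul]
  simp only [sub_dotProduct, dotProduct_sub, smul_dotProduct, dotProduct_smul, smul_eq_mul]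
  rw [dotProduct_comm (X *ᵥ w) (X *ᵥ β), hv, hv]
  field_simp
  ring

/-- Bayes factor for the Zellner g-prior against the null model: the marginal
likelihoods `m_γ` and `m_N` (with improper reference prior `1/σ²` on the intercept
and variance) are finite and positive, and
`m_γ / m_N = (1+g)^{(n−p−1)/2} (1 + g(1 − R²))^{−(n−1)/2}`. -/
theorem zellner_bayes_factor (n p : ℕ) (hn : 2 ≤ n)
    (X : Matrix (Fin n) (Fin p) ℝ)
    (hcent : Xᵀ *ᵥ (1 : Fin n → ℝ) = 0)
    (hM : IsUnit (Xᵀ * X).det)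
    (g : ℝ) (hg : 0 < g) (y : Fin n → ℝ)
    (yc : Fin n → ℝ) (hyc : yc = y - ((∑ i, y i) / n) • (1 : Fin n → ℝ))
    (hyc0 : yc ≠ 0)
    (R2 : ℝ) (hR2 : R2 = (yc ⬝ᵥ ((X * (Xᵀ * X)⁻¹ * Xᵀ) *ᵥ yc)) / (∑ i, (yc i) ^ 2))
    (mγ mN : ENNReal)
    (hmγ : mγ = ∫⁻ a : ℝ, ∫⁻ s in Set.Ioi (0 : ℝ),
        (∫⁻ β : Fin p → ℝ, ENNReal.ofReal
            ((2 * Real.pi * s) ^ (-(n : ℝ) / 2)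
              * Real.exp (-(∑ i, (y i - a - (X *ᵥ β) i) ^ 2) / (2 * s))
              * ((2 * Real.pi * g * s) ^ (-(p : ℝ) / 2)
                  * ((Xᵀ * X).det) ^ ((1 : ℝ) / 2)
                  * Real.exp (-(β ⬝ᵥ ((Xᵀ * X) *ᵥ β)) / (2 * g * s)))))
          * ENNReal.ofReal s⁻¹)
    (hmN : mN = ∫⁻ a : ℝ, ∫⁻ s in Set.Ioi (0 : ℝ),
        ENNReal.ofReal ((2 * Real.pi * s) ^ (-(n : ℝ) / 2)
          * Real.exp (-(∑ i, (y i - a) ^ 2) / (2 * s)) * s⁻¹)) :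
    mγ ≠ ⊤ ∧ 0 < mγ ∧ mN ≠ ⊤ ∧ 0 < mN ∧
      mγ / mN = ENNReal.ofReal
        ((1 + g) ^ (((n : ℝ) - p - 1) / 2)
          * (1 + g * (1 - R2)) ^ (-((n : ℝ) - 1) / 2)) := by
  have hpi := Real.pi_pos
  have hPD : (Xᵀ * X).PosDef := by
    have h : (Xᵀ * X).PosSemidef := by
      simpa [conjTranspose_eq_transpose_of_trivial] using posSemidef_conjTranspose_mul_self X
    exact h.posDef_iff_det_ne_zero.mpr hM.ne_zero
  have hdet := hPD.det_pos
  set m : ℝ := (∑ i, y i) / n with hm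
  set S : ℝ := ∑ i, (yc i) ^ 2 with hS
  set Q : ℝ := yc ⬝ᵥ ((X * (Xᵀ * X)⁻¹ * Xᵀ) *ᵥ yc) with hQ
  have hn0 : (n : ℝ) ≠ 0 := by
    have : n ≠ 0 := by omega
    exact_mod_cast this
  have hyi : ∀ i, y i = yc i + m := fun i => by simp [hyc]
  have hsum : ∑ i, yc i = 0 := by
    simp [hyc, Finset.sum_sub_distrib]
    rw [hm]; field_simp; ring
  have hXs : ∀ β : Fin p → ℝ, ∑ i, (X *ᵥ β) i = 0 := by
    intro β
    have : (1 : Fin n → ℝ) ⬝ᵥ (X *ᵥ β) = 0 := by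
      rw [dotProduct_mulVec, ← mulVec_transpose, hcent, zero_dotProduct]
    simpa [dotProduct] using this
  have hSpos : 0 < S := by
    obtain ⟨i, hi⟩ := Function.ne_iff.mp hyc0
    exact Finset.sum_pos' (fun i _ => sq_nonneg _)
      ⟨i, Finset.mem_univ _, by have : yc i ≠ 0 := hi; positivity⟩
  obtain ⟨w, hw⟩ : ∃ w, w = (Xᵀ * X)⁻¹ *ᵥ (Xᵀ *ᵥ yc) := ⟨_, rfl⟩
  have hcs := fun β => complete_sq X hM g hg yc β w hw
  set T : ℝ := S - g / (1 + g) * Q with hT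
  have hTpos : 0 < T := by
    have h := hcs ((g / (1 + g)) • w)
    rw [sub_self, mulVec_zero, dotProduct_zero, mul_zero, zero_add] at h
    change _ = T at h
    rw [← h]
    by_cases h0 : (g / (1 + g)) • w = 0
    · rw [h0]; simpa using hSpos
    · have := hPD.dotProduct_mulVec_pos h0
      rw [star_trivial] at this
      have h2 : 0 ≤ ∑ i, (yc i - (X *ᵥ ((g / (1 + g)) • w)) i) ^ 2 :=
        Finset.sum_nonneg fun i _ => sq_nonneg _
      positivity
  obtain ⟨K, hK, hF⟩ := marg n hn
  have hN : mN = ENNReal.ofReal (K * S ^ (-((n : ℝ) - 1) / 2)) := by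
    rw [hmN, ← hF m S hSpos]
    have : ∀ a, ∑ i, (y i - a) ^ 2 = n * (a - m)^2 + S := by
      intro a
      rw [show (a - m)^2 = (m - a)^2 by ring, ← sum_shift yc hsum (m - a)]
      exact Finset.sum_congr rfl fun i _ => by rw [hyi]; ring
    simp_rw [this]
  have hγ : mγ = ENNReal.ofReal ((1 + g) ^ (-(p:ℝ)/2) * (K * T ^ (-((n : ℝ) - 1) / 2))) := by
    rw [hmγ, ENNReal.ofReal_mul (by positivity), ← hF m T hTpos,
      ← lintegral_const_mul' _ _ ENNReal.ofReal_ne_top]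
    refine lintegral_congr fun a => ?_
    rw [← lintegral_const_mul' _ _ ENNReal.ofReal_ne_top]
    refine setLIntegral_congr_fun measurableSet_Ioi fun s hs => ?_
    have hs : 0 < s := hs
    have e : ∀ β : Fin p → ℝ, ENNReal.ofReal
            ((2 * Real.pi * s) ^ (-(n : ℝ) / 2)
              * Real.exp (-(∑ i, (y i - a - (X *ᵥ β) i) ^ 2) / (2 * s))
              * ((2 * Real.pi * g * s) ^ (-(p : ℝ) / 2)
                  * ((Xᵀ * X).det) ^ ((1 : ℝ) / 2)
                  * Real.exp (-(β ⬝ᵥ ((Xᵀ * X) *ᵥ β)) / (2 * g * s))))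
        = ENNReal.ofReal ((2 * Real.pi * s) ^ (-(n : ℝ) / 2) *
            Real.exp (-(n * (a - m) ^ 2 + T) / (2 * s)) *
            ((2 * Real.pi * g * s) ^ (-(p : ℝ) / 2) * ((Xᵀ * X).det) ^ ((1 : ℝ) / 2))) *
          ENNReal.ofReal (Real.exp (-((1 + g) / (2 * g * s)) *
            ((β - (g / (1 + g)) • w) ⬝ᵥ ((Xᵀ * X) *ᵥ (β - (g / (1 + g)) • w))))) := by
      intro β
      have e1 : ∑ i, (y i - a - (X *ᵥ β) i) ^ 2
          = n * (a - m)^2 + ∑ i, (yc i - (X *ᵥ β) i) ^ 2 := by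
        rw [show (a - m)^2 = (m - a)^2 by ring,
          ← sum_shift (fun i => yc i - (X *ᵥ β) i) (by simp [Finset.sum_sub_distrib, hsum, hXs])]
        exact Finset.sum_congr rfl fun i _ => by rw [hyi]; ring
      have e2 := hcs β
      rw [e1, ← ENNReal.ofReal_mul (by positivity)]
      congr 1
      generalize (β - (g / (1 + g)) • w) ⬝ᵥ ((Xᵀ * X) *ᵥ (β - (g / (1 + g)) • w)) = q at e2 ⊢
      generalize β ⬝ᵥ ((Xᵀ * X) *ᵥ β) = q2 at e2 ⊢
      generalize ∑ i, (yc i - (X *ᵥ β) i) ^ 2 = q3 at e2 ⊢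
      have e3 : Real.exp (-(n * (a - m)^2 + q3) / (2 * s)) * Real.exp (-q2 / (2 * g * s))
          = Real.exp (-(n * (a - m) ^ 2 + T) / (2 * s)) *
            Real.exp (-((1 + g) / (2 * g * s)) * q) := by
        rw [← Real.exp_add, ← Real.exp_add]
        congr 1
        have e4 : q3 = (1 + g) / g * q + T - q2 / g := by rw [hT]; linarith
        rw [e4]
        field_simp
        ring
      linear_combination ((2 * Real.pi * s) ^ (-(n : ℝ) / 2) *
        ((2 * Real.pi * g * s) ^ (-(p : ℝ) / 2) * ((Xᵀ * X).det) ^ ((1 : ℝ) / 2))) * e3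
    simp_rw [e]
    rw [lintegral_const_mul' _ _ ENNReal.ofReal_ne_top, gaussM _ hPD _ (by positivity),
      ← ENNReal.ofReal_mul (by positivity), ← ENNReal.ofReal_mul (by positivity),
      ← ENNReal.ofReal_mul (by positivity)]
    congr 1
    have e5 : (2 * Real.pi * g * s) ^ (-(p : ℝ) / 2) *
        (Real.pi / ((1 + g) / (2 * g * s))) ^ ((p:ℝ)/2) = (1 + g) ^ (-(p:ℝ)/2) := by
      rw [show Real.pi / ((1 + g) / (2 * g * s)) = (2 * Real.pi * g * s) * (1 + g)⁻¹ by field_simp,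
        Real.mul_rpow (y := (1 + g)⁻¹) (by positivity) (by positivity), ← mul_assoc,
        ← Real.rpow_add (by positivity), Real.inv_rpow (by positivity),
        ← Real.rpow_neg (by positivity), show -(p:ℝ)/2 + p/2 = 0 by ring, Real.rpow_zero, one_mul,
        neg_div]
    have e6 : ((Xᵀ * X).det) ^ ((1 : ℝ) / 2) * ((Xᵀ * X).det) ^ (-(1 : ℝ) / 2) = 1 := by
      rw [← Real.rpow_add hdet, show (1:ℝ)/2 + -1/2 = 0 by ring, Real.rpow_zero]
    rw [← e5]
    linear_combination ((2 * Real.pi * s) ^ (-(n : ℝ) / 2) *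
      Real.exp (-(n * (a - m) ^ 2 + T) / (2 * s)) * s⁻¹ * ((2 * Real.pi * g * s) ^ (-(p : ℝ) / 2) *
        (Real.pi / ((1 + g) / (2 * g * s))) ^ ((p:ℝ)/2))) * e6
  rw [hγ, hN]
  refine ⟨ENNReal.ofReal_ne_top, ENNReal.ofReal_pos.mpr (by positivity), ENNReal.ofReal_ne_top,
    ENNReal.ofReal_pos.mpr (by positivity), ?_⟩
  rw [← ENNReal.ofReal_div_of_pos (by positivity)]
  congr 1
  have e7 : 1 + g * (1 - R2) = (1 + g) * (T / S) := by
    rw [hR2, hT]; field_simp; ring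
  rw [e7, Real.mul_rpow (by positivity) (by positivity), Real.div_rpow hTpos.le hSpos.le,
    ← mul_assoc ((1 + g) ^ (((n:ℝ) - p - 1)/2)),
    ← Real.rpow_add (by positivity),
    show ((n:ℝ) - p - 1)/2 + -((n:ℝ) - 1)/2 = -(p:ℝ)/2 by ring]
  field_simp
end
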